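/- Let n = (V, {·,·}) be a Lie algebra over a field K of characteristic zero, R a Rota–Baxter operator of weight 1 on n, and let g = (V, [·,·]) be the Lie algebra with the induced bracket [x,y] = {R(x), y} − {R(y), x} + {x, y}. Then R is also a Rota–Baxter operator of weight 1 on g, i.e., [R(x), R(y)] = R([R(x), y] + [x, R(y)] + [x, y]) for all x, y ∈ V. -/

import Mathlib

/-- A Lie bracket on the `K`-vector space `V`, given as a plain binary product:
it is `K`-bilinear, alternating, and satisfies the Jacobi identity
(in Leibniz form). -/
def IsLieBr (K : Type*) {V : Type*} [Field K] [CharZero K] [AddCommGroup V] [Module K V]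
    (b : V → V → V) : Prop :=
  (∀ x : V, IsLinearMap K (b x)) ∧ (∀ y : V, IsLinearMap K fun x => b x y) ∧
  (∀ x : V, b x x = 0) ∧ ∀ x y z : V, b x (b y z) = b (b x y) z + b y (b x z)

/-- A Rota–Baxter operator of weight `lam` on the Lie algebra `(V, b)`. -/
def IsLieRB (K : Type*) {V : Type*} [Field K] [CharZero K] [AddCommGroup V] [Module K V]
    (b : V → V → V) (R : V →ₗ[K] V) (lam : K) : Prop :=
  ∀ x y : V, b (R x) (R y) = R (b (R x) y + b x (R y) + lam • b x y)

/-- The bracket `[x,y] = {R x, y} - {R y, x} + {x, y}` induced by an operator `R`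
on a Lie algebra `(V, b)`. -/
def indBr {K V : Type*} [Field K] [CharZero K] [AddCommGroup V] [Module K V]
    (b : V → V → V) (R : V →ₗ[K] V) : V → V → V :=
  fun x y => b (R x) y - b (R y) x + b x y

/-- A post-Lie algebra structure on the pair of Lie algebras `(V, gb)` and `(V, nb)`:
a bilinear product `mul` with `x·y - y·x = [x,y] - {x,y}`, `[x,y]·z = x·(y·z) - y·(x·z)`
and `x·{y,z} = {x·y, z} + {y, x·z}`. -/
def IsPostLie (K : Type*) {V : Type*} [Field K] [CharZero K] [AddCommGroup V] [Module K V]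
    (gb nb mul : V → V → V) : Prop :=
  (∀ x : V, IsLinearMap K (mul x)) ∧ (∀ y : V, IsLinearMap K fun x => mul x y) ∧
  (∀ x y : V, mul x y - mul y x = gb x y - nb x y) ∧
  (∀ x y z : V, mul (gb x y) z = mul x (mul y z) - mul y (mul x z)) ∧
  (∀ x y z : V, mul x (nb y z) = nb (mul x y) z + nb y (mul x z))

/-- A Lie bracket is skew-symmetric. -/
theorem IsLieBr.skew {K V : Type*} [Field K] [CharZero K] [AddCommGroup V] [Module K V]
    {b : V → V → V} (hb : IsLieBr K b) (x y : V) : -b y x = b x y := by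
  obtain ⟨hl, hr, ha, -⟩ := hb
  have h := ha (x + y)
  rw [(hl (x + y)).map_add, (hr x).map_add, (hr y).map_add, ha, ha, zero_add, add_zero] at h
  exact neg_eq_of_add_eq_zero_right h

/-- A Rota–Baxter operator of weight `1` sends the induced bracket to the original one. -/
theorem IsLieRB.map_indBr {K V : Type*} [Field K] [CharZero K] [AddCommGroup V] [Module K V]
    {b : V → V → V} (hb : IsLieBr K b) {R : V →ₗ[K] V} (hR : IsLieRB K b R 1) (x y : V) :
    R (indBr b R x y) = b (R x) (R y) := by
  rw [hR x y, indBr, one_smul, sub_eq_add_neg, hb.skew]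

/-- If `R` is an RB-operator of weight `1` on `n = (V, nb)`, then `R` is also an
RB-operator of weight `1` on `g = (V, indBr nb R)`. -/
theorem rb_on_induced_bracket (K : Type*) {V : Type*} [Field K] [CharZero K]
    [AddCommGroup V] [Module K V]
    (nb : V → V → V) (hn : IsLieBr K nb)
    (R : V →ₗ[K] V) (hR : IsLieRB K nb R 1) :
    IsLieRB K (indBr nb R) R 1 := by
  intro x y
  rw [one_smul, map_add, map_add, hR.map_indBr hn, hR.map_indBr hn, hR.map_indBr hn, indBr,
    sub_eq_add_neg, hn.skew]
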